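/- arXiv:1811.02161 — 2 statements merged into one kernel-verified Lean document; each statement's English description precedes it below -/
import Mathlib

section
/- There exists a universal constant C₁ > 0 with the following property. Let G be a finite simple graph on vertex set {1,…,n} (n ≥ 3) with edge set E, let K ∈ 𝒦(G), let 𝒫_n = {(i,j) : 1 ≤ i < j ≤ n}, N = n(n−1)/2, let 𝔼 ∈ ℝ^{n×N} be the matrix whose column indexed by (i,j) ∈ 𝒫_n equals e_i − e_j (standard basis vectors of ℝ^n), and set K̃ = 𝔼ᵀ K 𝔼. Let y ∈ {−1,1}^N, f ∈ (0, 1/2], m = ⌈Nf⌉ with m < N, C > 0, and consider the class ℱ = {K̃β : β ∈ ℝ^N, ‖β‖₂ ≤ C√N}. Let ρ > 0, B > 0 and ℓ : {−1,1} × ℝ → [0, B] satisfy |ℓ(y, t) − ℓ(y, t')| ≤ (1/ρ)|t − t'|. Then for every δ ∈ (0,1), with probability at least 1 − δ over a uniformly random subset S ⊆ 𝒫_n of size m, for all F ∈ ℱ: (1/(N−m)) Σ_{k ∉ S} ℓ(y_k, F_k) ≤ (1/m) Σ_{k ∈ S} ℓ(y_k, F_k) + 2C √(n · λ1(K)) /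 (ρ √(f(1−f))) + C₁ B (1 + √(ln(1/δ))) / ((1−f)√(Nf)). -/
noncomputable section
open Finset Matrix
open scoped Classical

-- The largest eigenvalue of a real symmetric matrix
-- (junk value `0` if the matrix is not symmetric).
open scoped Classical in
noncomputable def lam1 {ι : Type*} [Fintype ι] [DecidableEq ι] (M : Matrix ι ι ℝ) : ℝ :=
  if h : M.IsHermitian then ⨆ i, h.eigenvalues i else 0

/-- `𝒦(G)`: the set of symmetric PSD matrices with unit diagonal whose
off-diagonal entries vanish on non-edges of `G` (Gram matrices of orthonormal
representations of `G`). -/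
def gramSet {n : ℕ} (G : SimpleGraph (Fin n)) : Set (Matrix (Fin n) (Fin n) ℝ) :=
  {K | K.PosSemidef ∧ (∀ i, K i i = 1) ∧ ∀ i j, i ≠ j → ¬ G.Adj i j → K i j = 0}

/-- `𝒫_n`: the set of pairs `(i, j)` with `1 ≤ i < j ≤ n`. -/
abbrev Pairs (n : ℕ) := {q : Fin n × Fin n // q.1 < q.2}

/-- The `n × N` matrix `𝔼` whose column indexed by the pair `(i, j) ∈ 𝒫_n` is
`e_i - e_j`. -/
def pairDiffMat (n : ℕ) : Matrix (Fin n) (Pairs n) ℝ :=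
  fun i k => (if i = k.val.1 then 1 else 0) - (if i = k.val.2 then 1 else 0)

variable {V ι : Type*}

/-- The average of `φ` over the `m`-element subsets of `A`, defined by drawing the elements
one at a time without replacement. -/
def sliceAvg [DecidableEq V] : ℕ → Finset V → (Finset V → ℝ) → ℝ
  | 0, _, φ => φ ∅
  | m + 1, A, φ => (∑ x ∈ A, sliceAvg m (A.erase x) fun S => φ (insert x S)) / #A

lemma sum_powersetCard_insert_erase [DecidableEq V] (A : Finset V) (m : ℕ) (φ : Finset V → ℝ) :
    ∑ x ∈ A, ∑ S ∈ powersetCard m (A.erase x), φ (insert x S) =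
      (m + 1) * ∑ S ∈ powersetCard (m + 1) A, φ S := by
  have h : ∀ S ∈ powersetCard (m + 1) A, ((m : ℝ) + 1) * φ S = ∑ _x ∈ S, φ S := by
    intro S hS
    rw [mem_powersetCard] at hS
    simp [hS.2]
  rw [mul_sum, sum_congr rfl h, sum_sigma', sum_sigma']
  refine sum_bij' (fun p _ => ⟨insert p.1 p.2, p.1⟩) (fun p _ => ⟨p.2, p.1.erase p.2⟩) ?_ ?_ ?_ ?_ ?_
  · rintro ⟨x, S⟩ h
    simp only [mem_sigma, mem_powersetCard] at h ⊢
    have hx : x ∉ S := fun hx => by simpa using h.2.1 hx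
    refine ⟨⟨insert_subset h.1 (h.2.1.trans (erase_subset _ _)), ?_⟩, mem_insert_self _ _⟩
    rw [card_insert_of_notMem hx, h.2.2]
  · rintro ⟨S, x⟩ h
    simp only [mem_sigma, mem_powersetCard] at h ⊢
    refine ⟨h.1.1 h.2, erase_subset_erase _ h.1.1, ?_⟩
    rw [card_erase_of_mem h.2, h.1.2]; rfl
  · rintro ⟨x, S⟩ h
    simp only [mem_sigma, mem_powersetCard] at h
    have hx : x ∉ S := fun hx => by simpa using h.2.1 hx
    simp [hx]
  · rintro ⟨S, x⟩ h
    simp only [mem_sigma] at h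
    simp [h.2]
  · rintro ⟨x, S⟩ h
    rfl

lemma choose_mul_sliceAvg [DecidableEq V] (m : ℕ) (A : Finset V) (φ : Finset V → ℝ) :
    ((#A).choose m : ℝ) * sliceAvg m A φ = ∑ S ∈ powersetCard m A, φ S := by
  induction m generalizing A φ with
  | zero => simp [sliceAvg]
  | succ m ih =>
    rcases A.eq_empty_or_nonempty with rfl | hA
    · rw [powersetCard_eq_empty.2 (by simp)]; simp
    have hc : (0 : ℝ) < #A := by exact_mod_cast hA.card_pos
    obtain ⟨a, ha⟩ : ∃ a, #A = a + 1 := ⟨#A - 1, by have := hA.card_pos; omega⟩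
    have h1 : ((#A).choose (m + 1) : ℝ) * (m + 1) = #A * (a.choose m : ℝ) := by
      rw [ha]; exact_mod_cast (Nat.add_one_mul_choose_eq a m).symm
    have h2 := sum_powersetCard_insert_erase A m φ
    have h3 : ∀ x ∈ A, ∑ S ∈ powersetCard m (A.erase x), φ (insert x S) =
        (a.choose m : ℝ) * sliceAvg m (A.erase x) fun S => φ (insert x S) := by
      intro x hx
      rw [← ih, card_erase_of_mem hx, ha, Nat.add_sub_cancel]
    rw [sum_congr rfl h3, ← mul_sum] at h2
    have hm : (0 : ℝ) < m + 1 := by positivity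
    apply mul_left_cancel₀ hm.ne'
    rw [← h2, sliceAvg, ← mul_assoc, mul_comm ((m : ℝ) + 1), h1]
    field_simp

lemma abs_sum_div_sub_le {A : Finset V} (hA : A.Nonempty) {F G : V → ℝ} {B : ℝ}
    (h : ∀ x ∈ A, |F x - G x| ≤ B) : |(∑ x ∈ A, F x) / #A - (∑ x ∈ A, G x) / #A| ≤ B := by
  have hc : (0 : ℝ) < #A := by exact_mod_cast hA.card_pos
  rw [← sub_div, ← sum_sub_distrib, abs_div, abs_of_pos hc, div_le_iff₀ hc]
  refine (abs_sum_le_sum_abs _ _).trans ((sum_le_card_nsmul _ _ _ h).trans_eq ?_)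
  rw [nsmul_eq_mul, mul_comm]

lemma abs_sliceAvg_succ_sub_le [DecidableEq V] {B : ℝ} (m : ℕ) (A : Finset V) (hm : m < #A)
    (φ : Finset V → ℝ) (hφ : ∀ x S, |φ (insert x S) - φ S| ≤ B) :
    |sliceAvg (m + 1) A φ - sliceAvg m A φ| ≤ B := by
  induction m generalizing A φ with
  | zero =>
    have hA : A.Nonempty := card_pos.1 hm
    have hc : (0 : ℝ) < #A := by exact_mod_cast hA.card_pos
    have := abs_sum_div_sub_le hA (F := fun x => φ (insert x ∅)) (G := fun _ => φ ∅)
      fun x _ => hφ x ∅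
    simpa [sliceAvg, hc.ne'] using this
  | succ m ih =>
    have hA : A.Nonempty := card_pos.1 (by omega)
    rw [sliceAvg, sliceAvg]
    refine abs_sum_div_sub_le hA fun x hx => ih _ ?_ _ fun y S => ?_
    · rw [card_erase_of_mem hx]; omega
    · rw [insert_comm]; exact hφ _ _

lemma abs_sliceAvg_sub_le [DecidableEq V] {B : ℝ} (A : Finset V)
    (φ : Finset V → ℝ) (hφ : ∀ x S, |φ (insert x S) - φ S| ≤ B) {i j : ℕ} (hij : i ≤ j)
    (hj : j ≤ #A) : |sliceAvg j A φ - sliceAvg i A φ| ≤ B * (j - i) := by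
  induction j, hij using Nat.le_induction with
  | base => simp
  | succ j hij ih =>
    have h1 := ih (by omega)
    have h2 := abs_sliceAvg_succ_sub_le j A (by omega) φ hφ
    have h3 := abs_sub_le (sliceAvg (j + 1) A φ) (sliceAvg j A φ) (sliceAvg i A φ)
    push_cast
    linarith

lemma abs_sliceAvg_swap_le [DecidableEq V] {B : ℝ} (m : ℕ) (G : Finset V) {x y : V}
    (hx : x ∉ G) (hy : y ∉ G) (φ : Finset V → ℝ) (hφ : ∀ x S, |φ (insert x S) - φ S| ≤ B) :
    |sliceAvg m (insert y G) (fun S => φ (insert x S)) -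
      sliceAvg m (insert x G) (fun S => φ (insert y S))| ≤ 2 * B := by
  induction m generalizing G φ with
  | zero =>
    have h1 := hφ x ∅
    have h2 := hφ y ∅
    simp only [sliceAvg]
    rw [abs_le] at *
    constructor <;> linarith
  | succ m ih =>
    have hB : 0 ≤ B := (abs_nonneg _).trans (hφ x ∅)
    have hc : (0 : ℝ) < #G + 1 := by positivity
    simp only [sliceAvg]
    rw [sum_insert hy, sum_insert hx, erase_insert hy, erase_insert hx, card_insert_of_notMem hx,
      card_insert_of_notMem hy, ← sub_div]
    have e : (fun S => φ (insert x (insert y S))) = fun S => φ (insert y (insert x S)) := by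
      funext S; rw [insert_comm]
    rw [e, add_sub_add_left_eq_sub, ← sum_sub_distrib]
    push_cast
    rw [abs_div, abs_of_pos hc, div_le_iff₀ hc]
    refine (abs_sum_le_sum_abs _ _).trans ((sum_le_card_nsmul G _ (2 * B) ?_).trans ?_)
    · intro z hz
      rw [erase_insert_of_ne (by rintro rfl; exact hy hz),
        erase_insert_of_ne (by rintro rfl; exact hx hz)]
      have := ih (G.erase z) (fun h => hx (mem_of_mem_erase h)) (fun h => hy (mem_of_mem_erase h))
        (fun S => φ (insert z S)) (fun y S => by rw [insert_comm]; exact hφ _ _)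
      simp only [insert_comm z] at this
      exact this
    · rw [nsmul_eq_mul]; nlinarith

lemma sum_exp_div_card_le {A : Finset V} (hA : A.Nonempty) (H : V → ℝ) {D : ℝ} (l : ℝ)
    (h : ∀ x ∈ A, ∀ y ∈ A, |H x - H y| ≤ D) :
    (∑ x ∈ A, Real.exp (l * H x)) / #A ≤
      Real.exp (l * ((∑ x ∈ A, H x) / #A) + l ^ 2 * D ^ 2 / 2) := by
  have hc : (0 : ℝ) < #A := by exact_mod_cast hA.card_pos
  set μ := (∑ x ∈ A, H x) / #A with hμ
  have jensen : Real.exp (-(l * μ)) ≤ (∑ y ∈ A, Real.exp (-(l * H y))) / #A := by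
    have := convexOn_exp.map_sum_le (t := A) (w := fun _ => (#A : ℝ)⁻¹)
      (p := fun y => -(l * H y)) (fun _ _ => by positivity) (by simp [hc.ne']) (by simp)
    simp only [smul_eq_mul, ← mul_sum] at this
    have e : (#A : ℝ)⁻¹ * ∑ y ∈ A, -(l * H y) = -(l * μ) := by
      rw [hμ, sum_neg_distrib, ← mul_sum]; ring
    rwa [e, inv_mul_eq_div] at this
  have hcosh : ∀ x ∈ A, ∀ y ∈ A, Real.exp (l * H x) * Real.exp (-(l * H y)) +
      Real.exp (l * H y) * Real.exp (-(l * H x)) ≤ 2 * Real.exp (l ^ 2 * D ^ 2 / 2) := by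
    intro x hx y hy
    have h1 := Real.cosh_le_exp_half_sq (l * (H x - H y))
    rw [Real.cosh_eq] at h1
    have h2 : (H x - H y) ^ 2 ≤ D ^ 2 := sq_le_sq' (by linarith [abs_le.1 (h x hx y hy)])
      (by linarith [abs_le.1 (h x hx y hy)])
    have h3 : Real.exp ((l * (H x - H y)) ^ 2 / 2) ≤ Real.exp (l ^ 2 * D ^ 2 / 2) := by
      apply Real.exp_le_exp.2
      rw [mul_pow]
      gcongr
    rw [← Real.exp_add, ← Real.exp_add]
    have e1 : l * H x + -(l * H y) = l * (H x - H y) := by ring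
    have e2 : l * H y + -(l * H x) = -(l * (H x - H y)) := by ring
    rw [e1, e2]
    linarith
  have hdouble : (∑ x ∈ A, Real.exp (l * H x)) * (∑ y ∈ A, Real.exp (-(l * H y))) ≤
      #A * #A * Real.exp (l ^ 2 * D ^ 2 / 2) := by
    have h1 := sum_le_sum fun x hx => sum_le_sum fun y hy => hcosh x hx y hy
    simp only [sum_add_distrib, sum_const, nsmul_eq_mul] at h1
    rw [← sum_mul_sum, sum_comm, ← sum_mul_sum] at h1
    linarith
  rw [Real.exp_add, div_le_iff₀ hc]
  have hS : 0 ≤ ∑ x ∈ A, Real.exp (l * H x) := sum_nonneg fun _ _ => (Real.exp_pos _).le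
  have h4 : (∑ x ∈ A, Real.exp (l * H x)) * Real.exp (-(l * μ)) ≤
      #A * Real.exp (l ^ 2 * D ^ 2 / 2) := by
    refine (mul_le_mul_of_nonneg_left jensen hS).trans ?_
    rw [← mul_div_assoc, div_le_iff₀ hc]
    linarith
  have h5 : Real.exp (-(l * μ)) * Real.exp (l * μ) = 1 := by rw [← Real.exp_add]; simp
  calc (∑ x ∈ A, Real.exp (l * H x))
      = ((∑ x ∈ A, Real.exp (l * H x)) * Real.exp (-(l * μ))) * Real.exp (l * μ) := by
        rw [mul_assoc, h5, mul_one]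
    _ ≤ (#A * Real.exp (l ^ 2 * D ^ 2 / 2)) * Real.exp (l * μ) := by gcongr
    _ = _ := by ring

lemma sliceAvg_exp_le [DecidableEq V] {B : ℝ} (m : ℕ) (A : Finset V) (hm : m ≤ #A)
    (φ : Finset V → ℝ) (hφ : ∀ x S, |φ (insert x S) - φ S| ≤ B) (l : ℝ) :
    sliceAvg m A (fun S => Real.exp (l * φ S)) ≤
      Real.exp (l * sliceAvg m A φ + m * (l ^ 2 * (2 * B) ^ 2 / 2)) := by
  induction m generalizing A φ with
  | zero => simp [sliceAvg]
  | succ m ih =>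
    have hA : A.Nonempty := card_pos.1 (by omega)
    have hc : (0 : ℝ) < #A := by exact_mod_cast hA.card_pos
    simp only [sliceAvg]
    have hφ' : ∀ x y S, |φ (insert x (insert y S)) - φ (insert x S)| ≤ B := by
      intro x y S; rw [insert_comm]; exact hφ _ _
    have h1 : ∀ x ∈ A, sliceAvg m (A.erase x) (fun S => Real.exp (l * φ (insert x S))) ≤
        Real.exp (l * sliceAvg m (A.erase x) fun S => φ (insert x S)) *
          Real.exp (m * (l ^ 2 * (2 * B) ^ 2 / 2)) := by
      intro x hx
      rw [← Real.exp_add]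
      exact ih (A.erase x) (by rw [card_erase_of_mem hx]; omega) _ (hφ' x)
    have h2 := sum_exp_div_card_le hA
      (fun x => sliceAvg m (A.erase x) fun S => φ (insert x S)) (D := 2 * B) l (by
        intro x hx y hy
        rcases eq_or_ne x y with rfl | hxy
        · simpa using (abs_nonneg _).trans (hφ x ∅)
        have e1 : A.erase x = insert y ((A.erase x).erase y) :=
          (insert_erase (mem_erase.2 ⟨hxy.symm, hy⟩)).symm
        have e2 : A.erase y = insert x ((A.erase x).erase y) := by
          rw [erase_right_comm]; exact (insert_erase (mem_erase.2 ⟨hxy, hx⟩)).symm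
        rw [e1, e2]
        exact abs_sliceAvg_swap_le m _ (by simp) (by simp) φ hφ)
    calc _ ≤ (∑ x ∈ A, Real.exp (l * sliceAvg m (A.erase x) fun S => φ (insert x S)) *
          Real.exp (m * (l ^ 2 * (2 * B) ^ 2 / 2))) / #A := by
          gcongr with x hx; exact h1 x hx
      _ = (∑ x ∈ A, Real.exp (l * sliceAvg m (A.erase x) fun S => φ (insert x S))) / #A *
          Real.exp (m * (l ^ 2 * (2 * B) ^ 2 / 2)) := by rw [← sum_mul]; ring
      _ ≤ _ := by
          refine (mul_le_mul_of_nonneg_right h2 (Real.exp_pos _).le).trans_eq ?_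
          rw [← Real.exp_add]; congr 1; push_cast; ring

/-- Concentration for sampling without replacement. -/
lemma card_filter_sliceAvg_add_lt_le [DecidableEq V] {B : ℝ} (hB : 0 < B) (m : ℕ)
    (hm0 : 0 < m) (A : Finset V) (hm : m ≤ #A) (φ : Finset V → ℝ)
    (hφ : ∀ x S, |φ (insert x S) - φ S| ≤ B) {δ : ℝ} (hδ : 0 < δ) (hδ1 : δ < 1) :
    (#{S ∈ powersetCard m A | sliceAvg m A φ + B * √(8 * m * Real.log (1 / δ)) < φ S} : ℝ) ≤
      δ * #(powersetCard m A) := by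
  have hm' : (0 : ℝ) < m := by exact_mod_cast hm0
  have hL : 0 < Real.log (1 / δ) := Real.log_pos (by rw [lt_div_iff₀ hδ]; linarith)
  set L := Real.log (1 / δ) with hLdef
  set s := √(8 * m * L) with hs
  have hs2 : s ^ 2 = 8 * m * L := Real.sq_sqrt (by positivity)
  have hspos : 0 < s := Real.sqrt_pos.2 (by positivity)
  set l := s / (4 * m * B) with hl
  have hlpos : 0 < l := by positivity
  set μ := sliceAvg m A φ
  have h1 := sliceAvg_exp_le m A hm φ hφ l
  have hch : (0 : ℝ) ≤ (#A).choose m := by positivity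
  have h2 := mul_le_mul_of_nonneg_left h1 hch
  rw [choose_mul_sliceAvg] at h2
  have h3 : (#{S ∈ powersetCard m A | μ + B * s < φ S} : ℝ) * Real.exp (l * (μ + B * s)) ≤
      ∑ S ∈ powersetCard m A, Real.exp (l * φ S) := by
    rw [← nsmul_eq_mul]
    refine (card_nsmul_le_sum _ _ _ fun S hS => ?_).trans
      (sum_le_sum_of_subset_of_nonneg (filter_subset _ _) fun _ _ _ => (Real.exp_pos _).le)
    apply Real.exp_le_exp.2
    have := (mem_filter.1 hS).2
    gcongr
  have h4 := h3.trans h2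
  rw [card_powersetCard]
  have hδe : δ = Real.exp (-L) := by
    rw [hLdef, one_div, Real.log_inv, neg_neg, Real.exp_log hδ]
  have e : l * μ + m * (l ^ 2 * (2 * B) ^ 2 / 2) = -L + l * (μ + B * s) := by
    have : l * B * s = 2 * L := by
      rw [hl]; field_simp; linarith
    have h' : m * (l ^ 2 * (2 * B) ^ 2 / 2) = L := by
      rw [hl]; field_simp; rw [hs2]; ring
    rw [h']; linear_combination -this
  rw [e, Real.exp_add, ← hδe, ← mul_assoc] at h4
  have := le_of_mul_le_mul_right h4 (Real.exp_pos _)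
  linarith

lemma ciSup_add_le_symm [Finite ι] [Nonempty ι] (A u v : ι → ℝ)
    (h : ∀ i j, |u i - u j| ≤ |v i - v j|) {q : ℝ} (hq0 : 0 ≤ q) (hq1 : q ≤ 1) :
    q * (⨆ i, (A i + (q - 1) * u i)) + (1 - q) * (⨆ i, (A i + q * u i)) ≤
      q * (1 - q) * (⨆ i, (A i + v i)) + q * (1 - q) * (⨆ i, (A i - v i)) +
        (1 - 2 * (q * (1 - q))) * ⨆ i, A i := by
  obtain ⟨i, hi⟩ := exists_eq_ciSup_of_finite (f := fun i => A i + (q - 1) * u i)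
  obtain ⟨j, hj⟩ := exists_eq_ciSup_of_finite (f := fun i => A i + q * u i)
  rw [← hi, ← hj]
  have le (F : ι → ℝ) (k : ι) : F k ≤ ⨆ i, F i := le_ciSup (Set.finite_range F).bddAbove k
  have hp : 0 ≤ q * (1 - q) := mul_nonneg hq0 (by linarith)
  have h1 : A i + A j + |v i - v j| ≤ (⨆ i, (A i + v i)) + ⨆ i, (A i - v i) := by
    rcases abs_cases (v i - v j) with ⟨e, _⟩ | ⟨e, _⟩ <;> rw [e]
    · linarith [le (fun i => A i + v i) i, le (fun i => A i - v i) j]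
    · linarith [le (fun i => A i + v i) j, le (fun i => A i - v i) i]
  have h2 : q ^ 2 * A i + (1 - q) ^ 2 * A j ≤ (1 - 2 * (q * (1 - q))) * ⨆ i, A i := by
    have e : (1 - 2 * (q * (1 - q))) = q ^ 2 + (1 - q) ^ 2 := by ring
    rw [e, add_mul]
    have := le A i
    have := le A j
    gcongr
  have h3 : u j - u i ≤ |v i - v j| := by
    have := h j i
    rw [abs_sub_comm (v j)] at this
    exact (le_abs_self _).trans this
  have h4 := mul_le_mul_of_nonneg_left h1 hp
  have h5 := mul_le_mul_of_nonneg_left h3 hp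
  nlinarith

lemma symm_sqrt_le {E : Type*} [NormedAddCommGroup E] [InnerProductSpace ℝ E] (z w : E) {D p : ℝ}
    (hD : 0 ≤ D) (hp : 0 ≤ p) (hp1 : 2 * p ≤ 1) :
    p * √(‖z + w‖ ^ 2 + D) + p * √(‖z - w‖ ^ 2 + D) + (1 - 2 * p) * √(‖z‖ ^ 2 + D) ≤
      √(‖z‖ ^ 2 + (2 * p * ‖w‖ ^ 2 + D)) := by
  apply Real.le_sqrt_of_sq_le
  have ha := Real.sq_sqrt (show 0 ≤ ‖z + w‖ ^ 2 + D by positivity)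
  have hb := Real.sq_sqrt (show 0 ≤ ‖z - w‖ ^ 2 + D by positivity)
  have hc := Real.sq_sqrt (show 0 ≤ ‖z‖ ^ 2 + D by positivity)
  set a := √(‖z + w‖ ^ 2 + D)
  set b := √(‖z - w‖ ^ 2 + D)
  set c := √(‖z‖ ^ 2 + D)
  have par : ‖z + w‖ ^ 2 + ‖z - w‖ ^ 2 = 2 * (‖z‖ ^ 2 + ‖w‖ ^ 2) := by
    have := parallelogram_law_with_norm ℝ z w
    linarith
  have key : (p * a + p * b + (1 - 2 * p) * c) ^ 2 ≤ p * a ^ 2 + p * b ^ 2 + (1 - 2 * p) * c ^ 2 := by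
    have h1 : 0 ≤ p * p * (a - b) ^ 2 := by positivity
    have h2 : 0 ≤ p * (1 - 2 * p) * (a - c) ^ 2 :=
      mul_nonneg (mul_nonneg hp (by linarith)) (sq_nonneg _)
    have h3 : 0 ≤ p * (1 - 2 * p) * (b - c) ^ 2 :=
      mul_nonneg (mul_nonneg hp (by linarith)) (sq_nonneg _)
    nlinarith
  refine key.trans_eq ?_
  rw [ha, hb, hc]
  linear_combination p * par

/-- Symmetrization and contraction for Bernoulli sampling over a ball of linear functionals. -/
lemma bernoulli_sup_le [DecidableEq V] [Finite ι] [Nonempty ι] {E : Type*} [NormedAddCommGroup E]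
    [InnerProductSpace ℝ E] (w : V → E) (β : ι → E) {R : ℝ} (hR : ∀ i, ‖β i‖ ≤ R)
    (u : V → ι → ℝ) (hu : ∀ k i j, |u k i - u k j| ≤ |inner ℝ (w k) (β i) - inner ℝ (w k) (β j)|)
    {q : ℝ} (hq0 : 0 ≤ q) (hq1 : q ≤ 1) (s : Finset V) (z : E) :
    ∑ S ∈ s.powerset, q ^ #S * (1 - q) ^ (#s - #S) *
        (⨆ i, (inner ℝ z (β i) + ∑ k ∈ s, (q - if k ∈ S then 1 else 0) * u k i)) ≤
      R * √(‖z‖ ^ 2 + 2 * (q * (1 - q)) * ∑ k ∈ s, ‖w k‖ ^ 2) := by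
  have hR0 : 0 ≤ R := (norm_nonneg _).trans (hR (Classical.arbitrary ι))
  induction s using Finset.induction_on generalizing z with
  | empty =>
    simp only [powerset_empty, sum_singleton, card_empty, pow_zero, sum_empty, add_zero, mul_zero,
      Nat.sub_self, one_mul, Real.sqrt_sq (norm_nonneg z)]
    refine ciSup_le fun i => (real_inner_le_norm _ _).trans ?_
    rw [mul_comm]
    gcongr
    exact hR i
  | insert a s ha ih =>
    set p := q * (1 - q) with hp
    have hp0 : 0 ≤ p := mul_nonneg hq0 (by linarith)
    have hp1 : 2 * p ≤ 1 := by nlinarith [sq_nonneg (q - (1 - q))]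
    have hD : 0 ≤ 2 * p * ∑ k ∈ s, ‖w k‖ ^ 2 := by positivity
    rw [sum_insert ha, mul_add]
    refine le_trans ?_ (mul_le_mul_of_nonneg_left (symm_sqrt_le z (w a) hD hp0 hp1) hR0)
    have hp1' : 0 ≤ 1 - 2 * p := by linarith
    have i1 := mul_le_mul_of_nonneg_left (ih (z + w a)) hp0
    have i2 := mul_le_mul_of_nonneg_left (ih (z - w a)) hp0
    have i3 := mul_le_mul_of_nonneg_left (ih z) hp1'
    rw [mul_sum] at i1 i2 i3
    have i4 := add_le_add (add_le_add i1 i2) i3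
    rw [← sum_add_distrib, ← sum_add_distrib] at i4
    refine le_trans ?_ (i4.trans_eq (by ring))
    rw [sum_powerset_insert ha, ← sum_add_distrib]
    refine sum_le_sum fun S hS => ?_
    rw [mem_powerset] at hS
    have haS : a ∉ S := fun h => ha (hS h)
    have hcS : #S ≤ #s := card_le_card hS
    rw [card_insert_of_notMem ha, card_insert_of_notMem haS, Nat.add_sub_add_right,
      Nat.succ_sub hcS, pow_succ q, pow_succ (1 - q)]
    have e1 : ∀ i, inner ℝ z (β i) + ∑ k ∈ insert a s, (q - if k ∈ S then 1 else 0) * u k i =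
        (inner ℝ z (β i) + ∑ k ∈ s, (q - if k ∈ S then 1 else 0) * u k i) + q * u a i := by
      intro i; rw [sum_insert ha, if_neg haS]; ring
    have e2 : ∀ i, inner ℝ z (β i) +
          ∑ k ∈ insert a s, (q - if k ∈ insert a S then 1 else 0) * u k i =
        (inner ℝ z (β i) + ∑ k ∈ s, (q - if k ∈ S then 1 else 0) * u k i) + (q - 1) * u a i := by
      intro i
      rw [sum_insert ha, if_pos (mem_insert_self _ _)]
      have : ∀ k ∈ s, (q - if k ∈ insert a S then 1 else 0) * u k i =
          (q - if k ∈ S then 1 else 0) * u k i := by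
        intro k hk
        have : k ≠ a := by rintro rfl; exact ha hk
        simp [mem_insert, this]
      rw [sum_congr rfl this]; ring
    simp only [e1, e2, inner_add_left, inner_sub_left]
    have key := ciSup_add_le_symm
      (fun i => inner ℝ z (β i) + ∑ k ∈ s, (q - if k ∈ S then 1 else 0) * u k i) (u a)
      (fun i => inner ℝ (w a) (β i)) (hu a) hq0 hq1
    have hw : 0 ≤ q ^ #S * (1 - q) ^ (#s - #S) := by
      have : 0 ≤ 1 - q := by linarith
      positivity
    have key2 := mul_le_mul_of_nonneg_left key hw
    have e3 : ∀ i, inner ℝ z (β i) + inner ℝ (w a) (β i) +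
        ∑ k ∈ s, (q - if k ∈ S then 1 else 0) * u k i =
        inner ℝ z (β i) + ∑ k ∈ s, (q - if k ∈ S then 1 else 0) * u k i + inner ℝ (w a) (β i) :=
      fun i => by ring
    have e4 : ∀ i, inner ℝ z (β i) - inner ℝ (w a) (β i) +
        ∑ k ∈ s, (q - if k ∈ S then 1 else 0) * u k i =
        inner ℝ z (β i) + ∑ k ∈ s, (q - if k ∈ S then 1 else 0) * u k i - inner ℝ (w a) (β i) :=
      fun i => by ring
    simp only [e3, e4]
    rw [← hp] at key2
    linarith

lemma sum_bernstein_abs_le (n : ℕ) {q : ℝ} (hq0 : 0 ≤ q) (hq1 : q ≤ 1) :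
    ∑ j ∈ range (n + 1), (n.choose j : ℝ) * (q ^ j * (1 - q) ^ (n - j)) * |n * q - j| ≤
      √(n * (q * (1 - q))) := by
  have h1q : 0 ≤ 1 - q := by linarith
  have hv := congrArg (Polynomial.eval q) (bernsteinPolynomial.variance ℝ n)
  have hs := congrArg (Polynomial.eval q) (bernsteinPolynomial.sum ℝ n)
  simp [Polynomial.eval_finsetSum, bernsteinPolynomial] at hv hs
  apply Real.le_sqrt_of_sq_le
  have cs := sum_sq_le_sum_mul_sum_of_sq_le_mul (range (n + 1))
    (r := fun j => (n.choose j : ℝ) * (q ^ j * (1 - q) ^ (n - j)) * |n * q - j|)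
    (f := fun j => (n.choose j : ℝ) * q ^ j * (1 - q) ^ (n - j))
    (g := fun j => (n * q - j) ^ 2 * ((n.choose j : ℝ) * q ^ j * (1 - q) ^ (n - j)))
    (fun j _ => by positivity) (fun j _ => by positivity)
    (fun j _ => by rw [mul_pow, sq_abs]; exact le_of_eq (by ring))
  rw [hs, hv] at cs
  linarith

/-- Depoissonization: the average over a slice is close to the Bernoulli average. -/
lemma sliceAvg_le_bernoulli [Fintype V] [DecidableEq V] {B : ℝ} {m : ℕ}
    (hm : m ≤ Fintype.card V) (hV : 0 < Fintype.card V) (φ : Finset V → ℝ)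
    (hφ : ∀ x S, |φ (insert x S) - φ S| ≤ B) {q : ℝ} (hq : q = m / Fintype.card V) :
    sliceAvg m univ φ ≤ ∑ S ∈ (univ : Finset V).powerset,
      q ^ #S * (1 - q) ^ (#(univ : Finset V) - #S) * φ S +
        B * √(Fintype.card V * (q * (1 - q))) := by
  set N := Fintype.card V
  have hN : (0 : ℝ) < N := by exact_mod_cast hV
  have hmN : (m : ℝ) ≤ N := by exact_mod_cast hm
  have hq0 : 0 ≤ q := by rw [hq]; positivity
  have hq1 : q ≤ 1 := by rw [hq, div_le_one hN]; exact hmN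
  have h1q : 0 ≤ 1 - q := by linarith
  have hNq : N * q = m := by rw [hq]; field_simp
  have hB : 0 ≤ B := by
    obtain ⟨x⟩ := Fintype.card_pos_iff.1 hV
    exact (abs_nonneg _).trans (hφ x ∅)
  rw [card_univ, sum_powerset, card_univ]
  have e : ∀ j ∈ range (N + 1), ∑ S ∈ powersetCard j (univ : Finset V),
      q ^ #S * (1 - q) ^ (N - #S) * φ S =
      (N.choose j : ℝ) * (q ^ j * (1 - q) ^ (N - j)) * sliceAvg j univ φ := by
    intro j _
    have := choose_mul_sliceAvg j (univ : Finset V) φ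
    rw [card_univ] at this
    rw [mul_right_comm, this, sum_mul]
    refine sum_congr rfl fun S hS => ?_
    rw [(mem_powersetCard.1 hS).2]; ring
  rw [sum_congr rfl e]
  have hs := congrArg (Polynomial.eval q) (bernsteinPolynomial.sum ℝ N)
  simp [Polynomial.eval_finsetSum, bernsteinPolynomial] at hs
  have hb := mul_le_mul_of_nonneg_left (sum_bernstein_abs_le N hq0 hq1) hB
  refine le_trans ?_ (add_le_add_right hb _)
  have e0 : sliceAvg m univ φ =
      ∑ j ∈ range (N + 1), (N.choose j : ℝ) * (q ^ j * (1 - q) ^ (N - j)) * sliceAvg m univ φ := by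
    rw [← sum_mul]
    simp only [← mul_assoc]
    rw [hs, one_mul]
  rw [e0, mul_sum, ← sum_add_distrib]
  refine sum_le_sum fun j hj => ?_
  have hj' : j ≤ N := by simpa [Nat.lt_succ_iff] using hj
  have hd : sliceAvg m univ φ ≤ sliceAvg j univ φ + B * |N * q - j| := by
    rw [hNq]
    rcases le_total m j with h | h
    · have := abs_sliceAvg_sub_le univ φ hφ h (by rwa [card_univ])
      rw [abs_sub_comm (m : ℝ), abs_of_nonneg (sub_nonneg.2 (by exact_mod_cast h))]
      linarith [abs_le.1 this]
    · have := abs_sliceAvg_sub_le univ φ hφ h (by rwa [card_univ])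
      rw [abs_of_nonneg (sub_nonneg.2 (by exact_mod_cast h))]
      linarith [abs_le.1 this]
  have hw : 0 ≤ (N.choose j : ℝ) * (q ^ j * (1 - q) ^ (N - j)) := by positivity
  linarith [mul_le_mul_of_nonneg_left hd hw]

/-- Uniform deviation bound for sampling without replacement from a class of Lipschitz images of
linear functionals of bounded norm. -/
lemma card_filter_ciSup_lt_le [Fintype V] [DecidableEq V] [Finite ι] [Nonempty ι] {E : Type*}
    [NormedAddCommGroup E] [InnerProductSpace ℝ E] (w : V → E) (β : ι → E) {R : ℝ}
    (hR : ∀ i, ‖β i‖ ≤ R) (u : V → ι → ℝ)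
    (hu : ∀ k i j, |u k i - u k j| ≤ |inner ℝ (w k) (β i) - inner ℝ (w k) (β j)|)
    {B : ℝ} (hB : 0 < B) (huB : ∀ k i, u k i ∈ Set.Icc 0 B) {m : ℕ} (hm0 : 0 < m)
    (hm : m ≤ Fintype.card V) {q : ℝ} (hq : q = m / Fintype.card V)
    {δ : ℝ} (hδ : 0 < δ) (hδ1 : δ < 1) :
    (#{S ∈ powersetCard m (univ : Finset V) | R * √(2 * (q * (1 - q)) * ∑ k, ‖w k‖ ^ 2) +
        B * √(Fintype.card V * (q * (1 - q))) + B * √(8 * m * Real.log (1 / δ)) <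
          ⨆ i, ∑ k, (q - if k ∈ S then 1 else 0) * u k i} : ℝ) ≤
      δ * #(powersetCard m (univ : Finset V)) := by
  have hV : 0 < Fintype.card V := by omega
  have hq0 : 0 ≤ q := by rw [hq]; positivity
  have hq1 : q ≤ 1 := by
    rw [hq, div_le_one (by exact_mod_cast hV)]; exact_mod_cast hm
  set φ : Finset V → ℝ := fun S => ⨆ i, ∑ k, (q - if k ∈ S then 1 else 0) * u k i with hφdef
  have hφ : ∀ x S, |φ (insert x S) - φ S| ≤ B := by
    intro x S
    have hterm : ∀ i, ∑ k, (q - if k ∈ insert x S then 1 else 0) * u k i ≤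
          ∑ k, (q - if k ∈ S then 1 else 0) * u k i ∧
        ∑ k, (q - if k ∈ S then 1 else 0) * u k i ≤
          ∑ k, (q - if k ∈ insert x S then 1 else 0) * u k i + B := by
      intro i
      have e : ∑ k, (q - if k ∈ S then 1 else 0) * u k i -
          ∑ k, (q - if k ∈ insert x S then 1 else 0) * u k i = if x ∈ S then 0 else u x i := by
        rw [← sum_sub_distrib, sum_eq_single x]
        · by_cases hx : x ∈ S <;> simp [hx]; ring
        · intro k _ hk; simp [mem_insert, hk]
        · simp
      have := huB x i
      split_ifs at e
      · constructor <;> linarith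
      · constructor <;> linarith [this.1, this.2]
    have le (F : ι → ℝ) (k : ι) : F k ≤ ⨆ i, F i := le_ciSup (Set.finite_range F).bddAbove k
    have h1 : φ (insert x S) ≤ φ S := ciSup_le fun i => (hterm i).1.trans
      (le (fun i => ∑ k, (q - if k ∈ S then 1 else 0) * u k i) i)
    have h2 : φ S ≤ φ (insert x S) + B :=
      ciSup_le fun i => (hterm i).2.trans (add_le_add_left
        (le (fun i => ∑ k, (q - if k ∈ insert x S then 1 else 0) * u k i) i) B)
    rw [abs_le]; constructor <;> linarith
  have h1 := card_filter_sliceAvg_add_lt_le hB m hm0 (univ : Finset V) hm φ hφ hδ hδ1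
  have h2 := sliceAvg_le_bernoulli hm hV φ hφ hq
  have h3 := bernoulli_sup_le w β hR u hu hq0 hq1 univ 0
  simp only [inner_zero_left, zero_add, norm_zero, ne_eq, OfNat.ofNat_ne_zero, not_false_eq_true,
    zero_pow] at h3
  refine le_trans ?_ h1
  refine Nat.cast_le.2 (card_le_card (monotone_filter_right _ fun S _ hS => ?_))
  exact lt_of_le_of_lt (by linarith) hS

lemma sum_pairs_sub_sq_le {n : ℕ} (x : Fin n → ℝ) :
    ∑ k : Pairs n, (x k.val.1 - x k.val.2) ^ 2 ≤ n * ∑ i, x i ^ 2 := by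
  have h0 : ∑ k : Pairs n, (x k.val.1 - x k.val.2) ^ 2 =
      ∑ i, ∑ j, if i < j then (x i - x j) ^ 2 else 0 := by
    rw [← sum_product', ← sum_filter, univ_product_univ]
    exact (sum_subtype (univ.filter fun q : Fin n × Fin n => q.1 < q.2) (by simp)
      fun q => (x q.1 - x q.2) ^ 2).symm
  have h1 : ∑ i, ∑ j, (if i < j then (x i - x j) ^ 2 else 0) =
      ∑ i, ∑ j, if j < i then (x i - x j) ^ 2 else 0 := by
    rw [sum_comm]
    exact sum_congr rfl fun i _ => sum_congr rfl fun j _ => by rw [← neg_sub, neg_sq]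
  have h2 : (∑ i, ∑ j, if i < j then (x i - x j) ^ 2 else 0) +
      (∑ i, ∑ j, if j < i then (x i - x j) ^ 2 else 0) ≤ ∑ i, ∑ j, (x i - x j) ^ 2 := by
    simp only [← sum_add_distrib]
    refine sum_le_sum fun i _ => sum_le_sum fun j _ => ?_
    split_ifs with h h' <;> first | (exfalso; omega) | nlinarith [sq_nonneg (x i - x j)]
  have h3 : ∑ i, ∑ j, (x i - x j) ^ 2 = 2 * (n * ∑ i, x i ^ 2) - 2 * (∑ i, x i) ^ 2 := by
    simp only [sub_sq, sum_add_distrib, sum_sub_distrib, sum_const, card_univ, Fintype.card_fin,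
      nsmul_eq_mul, ← mul_sum, ← sum_mul, mul_assoc]
    ring
  nlinarith [sq_nonneg (∑ i, x i)]

lemma sum_sq_transpose_pairDiffMat_mul_le {n : ℕ} {κ : Type*} [Fintype κ]
    (M : Matrix (Fin n) κ ℝ) :
    ∑ k, ∑ l, ((pairDiffMat n)ᵀ * M) k l ^ 2 ≤ n * ∑ i, ∑ l, M i l ^ 2 := by
  rw [sum_comm, sum_comm (s := (univ : Finset (Fin n))), mul_sum]
  refine sum_le_sum fun l _ => ?_
  refine (sum_congr rfl fun k _ => ?_).trans_le (sum_pairs_sub_sq_le fun i => M i l)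
  simp [mul_apply, pairDiffMat, sub_mul, sum_sub_distrib]

lemma sum_sq_le_lam1_mul_trace {n : ℕ} {K : Matrix (Fin n) (Fin n) ℝ} (hK : K.PosSemidef) :
    ∑ i, ∑ j, K i j ^ 2 ≤ lam1 K * K.trace := by
  have hH := hK.isHermitian
  have hsq : ∑ i, ∑ j, K i j ^ 2 = (K * K).trace := by
    simp only [trace, Matrix.diag, mul_apply]
    refine sum_congr rfl fun i _ => sum_congr rfl fun j _ => ?_
    rw [sq]; congr 1
    simpa using hH.apply j i
  have hev : (K * K).trace = ∑ i, hH.eigenvalues i ^ 2 := by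
    set U := hH.eigenvectorUnitary
    have hsp := hH.spectral_theorem
    rw [Unitary.conjStarAlgAut_apply] at hsp
    have hU : star (U : Matrix (Fin n) (Fin n) ℝ) * U = 1 := Unitary.coe_star_mul_self U
    have e : K * K = (U : Matrix (Fin n) (Fin n) ℝ) *
        (diagonal (RCLike.ofReal ∘ hH.eigenvalues) * diagonal (RCLike.ofReal ∘ hH.eigenvalues)) *
          star (U : Matrix (Fin n) (Fin n) ℝ) := by
      conv_lhs => rw [hsp]
      simp only [Matrix.mul_assoc]
      congr 2
      rw [← Matrix.mul_assoc (star (U : Matrix (Fin n) (Fin n) ℝ)), hU, Matrix.one_mul]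
    rw [e, trace_mul_comm, ← Matrix.mul_assoc, hU, Matrix.one_mul, diagonal_mul_diagonal,
      trace_diagonal]
    simp [sq]
  rw [hsq, hev, hH.trace_eq_sum_eigenvalues, mul_sum]
  refine sum_le_sum fun i _ => ?_
  have h1 : hH.eigenvalues i ≤ lam1 K := by
    rw [lam1, dif_pos hH]
    exact le_ciSup (Set.finite_range _).bddAbove i
  have h2 := hK.eigenvalues_nonneg i
  simp only [RCLike.ofReal_real_eq_id, id]
  nlinarith

lemma sum_sq_pairDiff_gram_le {n : ℕ} {G : SimpleGraph (Fin n)} {K : Matrix (Fin n) (Fin n) ℝ}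
    (hK : K ∈ gramSet G) :
    ∑ k, ∑ l, ((pairDiffMat n)ᵀ * K * pairDiffMat n) k l ^ 2 ≤ (n : ℝ) ^ 3 * lam1 K := by
  have h1 := sum_sq_transpose_pairDiffMat_mul_le (K * pairDiffMat n)
  have h2 := sum_sq_transpose_pairDiffMat_mul_le K
  have hKt : Kᵀ = K := by simpa using hK.1.isHermitian.eq
  have h3 : ∑ i, ∑ l, (K * pairDiffMat n) i l ^ 2 = ∑ k, ∑ l, ((pairDiffMat n)ᵀ * K) k l ^ 2 := by
    rw [sum_comm]
    refine sum_congr rfl fun k _ => sum_congr rfl fun l _ => ?_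
    rw [← transpose_apply (K * pairDiffMat n), transpose_mul, hKt]
  have h4 := sum_sq_le_lam1_mul_trace hK.1
  have h5 : K.trace = n := by simp [trace, hK.2.1]
  rw [h5] at h4
  rw [Matrix.mul_assoc]
  have hn : (0 : ℝ) ≤ n := by positivity
  calc _ ≤ (n : ℝ) * (n * (lam1 K * n)) := by
        refine h1.trans ?_
        rw [h3]
        gcongr
        exact h2.trans (by gcongr)
    _ = _ := by ring

lemma card_pairs (n : ℕ) : 2 * Fintype.card (Pairs n) = n * (n - 1) := by
  have h0 : Fintype.card (Pairs n) = #{q : Fin n × Fin n | q.1 < q.2} := Fintype.card_subtype _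
  have h1 : #{q : Fin n × Fin n | q.1 < q.2} = #{q : Fin n × Fin n | q.2 < q.1} :=
    card_bij' (fun q _ => q.swap) (fun q _ => q.swap) (by simp) (by simp) (by simp) (by simp)
  have h2 : (univ : Finset (Fin n)).offDiag =
      ({q | q.1 < q.2} : Finset (Fin n × Fin n)) ∪ ({q | q.2 < q.1} : Finset (Fin n × Fin n)) := by
    ext q; simp [mem_offDiag, lt_or_lt_iff_ne]
  have h3 : Disjoint ({q | q.1 < q.2} : Finset (Fin n × Fin n))
      ({q | q.2 < q.1} : Finset (Fin n × Fin n)) :=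
    disjoint_filter.2 fun q _ h => h.asymm
  have h4 := congrArg card h2
  rw [card_union_of_disjoint h3, offDiag_card, card_univ, Fintype.card_fin, ← h1, ← h0] at h4
  rw [Nat.mul_sub, mul_one]
  omega

lemma mul_card_mul_card_sub_ge {n N m f : ℝ} (hn : 3 ≤ n) (hN : 2 * N = n * (n - 1)) (hf : 0 < f)
    (hf2 : f ≤ 1 / 2) (hm1 : N * f ≤ m) (hm2 : m < N * f + 1) :
    N ^ 2 * (f * (1 - f)) * n ^ 2 ≤ (n - 1) * (n + 12) * (m * (N - m)) := by
  have hNn : n ≤ N := by nlinarith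
  have hT : 0 ≤ N ^ 2 * (f * (1 - f)) :=
    mul_nonneg (sq_nonneg _) (mul_nonneg hf.le (by linarith))
  set T := N ^ 2 * (f * (1 - f)) with hTdef
  have hMT : m * (N - m) = T + (m - N * f) * (N - m - N * f) := by rw [hTdef]; ring
  have hn' : 0 ≤ (n - 1) * (n + 12) := mul_nonneg (by linarith) (by linarith)
  rcases le_or_gt 0 (N - m - N * f) with h | h
  · have h1 : T ≤ m * (N - m) := by
      rw [hMT]; linarith [mul_nonneg (sub_nonneg.2 hm1) h]
    have h2 : n ^ 2 ≤ (n - 1) * (n + 12) := by nlinarith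
    calc T * n ^ 2 ≤ T * ((n - 1) * (n + 12)) := by gcongr
      _ ≤ m * (N - m) * ((n - 1) * (n + 12)) := by gcongr
      _ = _ := by ring
  · have hNf2 : N * f ≤ N / 2 := by nlinarith
    have h1 : T - 1 ≤ m * (N - m) := by
      rw [hMT]
      nlinarith [mul_nonneg (sub_nonneg.2 hm1) (show 0 ≤ 1 - (m + N * f - N) by linarith)]
    have h2 : n ^ 2 / 6 ≤ T := by
      have e : T = (N * f) * (N - N * f) := by rw [hTdef]; ring
      have a1 : (N - 1) / 2 ≤ N * f := by linarith
      have a2 : N / 2 ≤ N - N * f := by linarith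
      have a3 : (N - 1) / 2 * (N / 2) ≤ T := by
        rw [e]
        exact mul_le_mul a1 a2 (by linarith) (by nlinarith)
      nlinarith
    have h3 : (n - 1) * (n + 12) * (T - 1) ≤ (n - 1) * (n + 12) * (m * (N - m)) := by gcongr
    refine le_trans ?_ h3
    have h4 : 0 ≤ (T - n ^ 2 / 6) * (11 * n - 12) :=
      mul_nonneg (by linarith) (by linarith)
    nlinarith [mul_nonneg (sub_nonneg.2 hn) (sub_nonneg.2 hn),
      mul_nonneg (mul_nonneg (sub_nonneg.2 hn) (sub_nonneg.2 hn)) (sub_nonneg.2 hn)]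

lemma depoissonization_error_le {N m f B q : ℝ} (hf : 0 < f) (hf1 : 0 < 1 - f) (hN : 0 < N)
    (hm1 : N * f ≤ m) (hu0 : 0 < N - m) (hu3 : N * (1 - f) ≤ 3 * (N - m)) (hB : 0 < B)
    (hp : q * (1 - q) = m * (N - m) / N ^ 2) :
    N / (m * (N - m)) * (B * √(N * (q * (1 - q)))) ≤ 3 * B / ((1 - f) * √(N * f)) := by
  have hNf : 0 < N * f := by positivity
  have hm0 : 0 < m := by linarith
  have hM : 0 < m * (N - m) := by positivity
  refine (pow_le_pow_iff_left₀ (by positivity) (by positivity) two_ne_zero).1 ?_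
  rw [mul_pow, mul_pow, hp, Real.sq_sqrt (by positivity), div_pow (3 * B)]
  have e : (N / (m * (N - m))) ^ 2 * (B ^ 2 * (N * (m * (N - m) / N ^ 2))) =
      B ^ 2 * N / (m * (N - m)) := by field_simp
  rw [e, div_le_div_iff₀ hM (by positivity), mul_pow, mul_pow, Real.sq_sqrt hNf.le]
  have h1 : N * (1 - f) ^ 2 ≤ 3 * (N - m) := by
    refine le_trans ?_ hu3
    rw [sq, ← mul_assoc]
    exact mul_le_of_le_one_right (by positivity) (by linarith)
  calc B ^ 2 * N * ((1 - f) ^ 2 * (N * f)) = B ^ 2 * (N * (1 - f) ^ 2 * (N * f)) := by ring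
    _ ≤ B ^ 2 * (3 * (N - m) * m) := by gcongr
    _ ≤ 3 ^ 2 * B ^ 2 * (m * (N - m)) := by nlinarith [mul_pos (pow_pos hB 2) hM]

lemma concentration_error_le {N m f B L : ℝ} (hf : 0 < f) (hf1 : 0 < 1 - f) (hN : 0 < N)
    (hm1 : N * f ≤ m) (hu0 : 0 < N - m) (hu3 : N * (1 - f) ≤ 3 * (N - m)) (hB : 0 < B)
    (hL : 0 ≤ L) :
    N / (m * (N - m)) * (B * √(8 * m * L)) ≤ 9 * B * √L / ((1 - f) * √(N * f)) := by
  have hNf : 0 < N * f := by positivity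
  have hm0 : 0 < m := by linarith
  have h1 : √(8 * m * L) ≤ 3 * √m * √L := by
    apply Real.sqrt_le_iff.2 ⟨by positivity, ?_⟩
    rw [mul_pow, mul_pow, Real.sq_sqrt hm0.le, Real.sq_sqrt hL]
    nlinarith [mul_nonneg hm0.le hL]
  have hsm : √(N * f) ≤ √m := Real.sqrt_le_sqrt hm1
  have hs : 0 < √(N * f) := Real.sqrt_pos.2 hNf
  have hm2 : √m * √m = m := Real.mul_self_sqrt hm0.le
  have hsm0 : 0 < √m := Real.sqrt_pos.2 hm0
  calc _ ≤ N / (m * (N - m)) * (B * (3 * √m * √L)) := by gcongr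
    _ = 9 * B * √L * (N / (3 * (N - m) * √m)) := by
        have e : N / (m * (N - m)) = N / (√m * √m * (N - m)) := by rw [hm2]
        rw [e]
        field_simp; ring
    _ ≤ 9 * B * √L * (N / (N * (1 - f) * √(N * f))) := by gcongr
    _ = _ := by field_simp

/-- The deviation threshold is dominated by the error terms of the generalization bound as soon
as the complexity term is at most `B`. -/
lemma threshold_le {n N m f C ρ B lam L W q : ℝ} (hn : 3 ≤ n) (hN : 2 * N = n * (n - 1))
    (hf : 0 < f) (hf2 : f ≤ 1 / 2) (hm1 : N * f ≤ m) (hm2 : m < N * f + 1) (hmN : m < N)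
    (hC : 0 < C) (hρ : 0 < ρ) (hB : 0 < B) (hL : 0 ≤ L) (hq : q = m / N)
    (hW : W ≤ n ^ 3 * lam / ρ ^ 2) (hlam : 0 ≤ lam)
    (hX : 2 * C * √(n * lam) / (ρ * √(f * (1 - f))) ≤ B) :
    N / (m * (N - m)) * (C * √N * √(2 * (q * (1 - q)) * W) + B * √(N * (q * (1 - q))) +
        B * √(8 * m * L)) ≤
      2 * C * √(n * lam) / (ρ * √(f * (1 - f))) +
        9 * B * (1 + √L) / ((1 - f) * √(N * f)) := by
  have hNn : n ≤ N := by nlinarith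
  have hN0 : 0 < N := by linarith
  have hNf : 0 < N * f := by positivity
  have hm0 : 0 < m := by linarith
  have hu0 : 0 < N - m := by linarith
  have hf1 : 0 < 1 - f := by linarith
  have hff : 0 < f * (1 - f) := by positivity
  have hM : 0 < m * (N - m) := by positivity
  have hp : q * (1 - q) = m * (N - m) / N ^ 2 := by rw [hq]; field_simp
  have hu3 : N * (1 - f) ≤ 3 * (N - m) := by nlinarith
  have hs : 0 < √(N * f) := Real.sqrt_pos.2 hNf
  have hs2 : √(N * f) ^ 2 = N * f := Real.sq_sqrt hNf.le
  set s := √(N * f) with hsdef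
  set X := 2 * C * √(n * lam) / (ρ * √(f * (1 - f))) with hXdef
  have hX0 : 0 ≤ X := by positivity
  have hY : 9 * B * (1 + √L) / ((1 - f) * s) =
      6 * B / ((1 - f) * s) + 3 * B / ((1 - f) * s) + 9 * B * √L / ((1 - f) * s) := by ring
  have hcomplexity : N / (m * (N - m)) * (C * √N * √(2 * (q * (1 - q)) * W)) ≤
      X + 6 * B / ((1 - f) * s) := by
    have h1 : N / (m * (N - m)) * (C * √N * √(2 * (q * (1 - q)) * W)) ≤ X * (1 + 12 / n) := by
      refine (pow_le_pow_iff_left₀ (by positivity) (by positivity) two_ne_zero).1 ?_ 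
      have hWp : √(2 * (q * (1 - q)) * W) ^ 2 ≤
          2 * (m * (N - m) / N ^ 2) * (n ^ 3 * lam / ρ ^ 2) := by
        rw [hp]
        refine (pow_le_pow_left₀ (Real.sqrt_nonneg _) (Real.sqrt_le_sqrt
          (mul_le_mul_of_nonneg_left hW (by positivity))) 2).trans_eq (Real.sq_sqrt (by positivity))
      have hX2 : X ^ 2 = 4 * C ^ 2 * (n * lam) / (ρ ^ 2 * (f * (1 - f))) := by
        rw [hXdef, div_pow, mul_pow, mul_pow, mul_pow, Real.sq_sqrt (by positivity),
          Real.sq_sqrt hff.le]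
        ring
      have key := mul_card_mul_card_sub_ge hn hN hf hf2 hm1 hm2
      calc _ = (N / (m * (N - m))) ^ 2 * (C ^ 2 * N * √(2 * (q * (1 - q)) * W) ^ 2) := by
            rw [mul_pow, mul_pow, mul_pow, Real.sq_sqrt hN0.le]
        _ ≤ (N / (m * (N - m))) ^ 2 *
              (C ^ 2 * N * (2 * (m * (N - m) / N ^ 2) * (n ^ 3 * lam / ρ ^ 2))) := by gcongr
        _ = 2 * C ^ 2 * (n * lam) / ρ ^ 2 * (N * n ^ 2 / (m * (N - m))) := by
            field_simp
        _ ≤ 2 * C ^ 2 * (n * lam) / ρ ^ 2 * (2 / (f * (1 - f)) * (1 + 12 / n)) := by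
            gcongr
            rw [div_le_iff₀ hM]
            have e : 2 / (f * (1 - f)) * (1 + 12 / n) * (m * (N - m)) =
                2 * ((n + 12) * (m * (N - m))) / (n * (f * (1 - f))) := by
              field_simp
            rw [e, le_div_iff₀ (by positivity)]
            have hn1 : 0 < n - 1 := by linarith
            refine le_of_mul_le_mul_left ?_ hn1
            have e2 : (n - 1) * (N * n ^ 2 * (n * (f * (1 - f)))) =
                2 * (N ^ 2 * (f * (1 - f)) * n ^ 2) := by
              linear_combination (-(N * n ^ 2 * (f * (1 - f)))) * hN
            rw [e2]
            linarith
        _ = X ^ 2 * (1 + 12 / n) := by rw [hX2]; field_simp; ring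
        _ ≤ X ^ 2 * (1 + 12 / n) ^ 2 := by
            gcongr
            have : 0 ≤ 12 / n := by positivity
            nlinarith
        _ = _ := by ring
    have hsn : s ≤ n / 2 := by
      refine (pow_le_pow_iff_left₀ (by positivity) (by positivity) two_ne_zero).1 ?_ 
      rw [hs2]; nlinarith
    have h2 : X * (12 / n) ≤ 6 * B / ((1 - f) * s) := by
      calc X * (12 / n) ≤ B * (12 / n) := by gcongr
        _ = 6 * B / (n / 2) := by field_simp; norm_num
        _ ≤ 6 * B / ((1 - f) * s) := by
            gcongr
            nlinarith
    linarith
  have hdepoisson := depoissonization_error_le hf hf1 hN0 hm1 hu0 hu3 hB hp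
  have hconcentration := concentration_error_le hf hf1 hN0 hm1 hu0 hu3 hB hL
  rw [hY, mul_add, mul_add]
  linarith

/-- generalization bound for Pref-Rank with the pairwise-difference
embedding: with `K ∈ 𝒦(G)` and `K̃ = 𝔼ᵀ K 𝔼`, with probability at least `1 - δ`
over a uniformly random `S ⊆ 𝒫_n` of size `m = ⌈Nf⌉`, for all `F` in
`{K̃β : ‖β‖₂ ≤ C√N}` the test error is at most the training error plus
`2C √(n λ1(K))/(ρ √(f(1-f))) + C₁B(1+√ln(1/δ))/((1-f)√(Nf))`. -/
theorem stmt_12 : ∃ C₁ : ℝ, 0 < C₁ ∧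
    ∀ (n : ℕ), 3 ≤ n →
    ∀ (G : SimpleGraph (Fin n)) (K : Matrix (Fin n) (Fin n) ℝ), K ∈ gramSet G →
    ∀ Ktil : Matrix (Pairs n) (Pairs n) ℝ,
      Ktil = (pairDiffMat n)ᵀ * K * pairDiffMat n →
    ∀ N : ℕ, N = Fintype.card (Pairs n) →
    ∀ y : Pairs n → ℝ, (∀ k, y k = 1 ∨ y k = -1) →
    ∀ f : ℝ, 0 < f → f ≤ 1 / 2 →
    ∀ m : ℕ, m = ⌈(N : ℝ) * f⌉₊ → m < N →
    ∀ C : ℝ, 0 < C →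
    ∀ ρ B : ℝ, 0 < ρ → 0 < B →
    ∀ ℓ : ℝ → ℝ → ℝ,
      (∀ a t, (a = 1 ∨ a = -1) → ℓ a t ∈ Set.Icc 0 B) →
      (∀ a t t', (a = 1 ∨ a = -1) → |ℓ a t - ℓ a t'| ≤ (1 / ρ) * |t - t'|) →
    ∀ δ : ℝ, 0 < δ → δ < 1 →
    (((Finset.powersetCard m (Finset.univ : Finset (Pairs n))).filter
        (fun S : Finset (Pairs n) =>
          ∀ β : Pairs n → ℝ,
            Real.sqrt (β ⬝ᵥ β) ≤ C * Real.sqrt (N : ℝ) →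
            (1 / ((N : ℝ) - m)) * ∑ k ∈ Sᶜ, ℓ (y k) ((Ktil *ᵥ β) k) ≤
              (1 / (m : ℝ)) * ∑ k ∈ S, ℓ (y k) ((Ktil *ᵥ β) k) +
              2 * C * Real.sqrt ((n : ℝ) * lam1 K) / (ρ * Real.sqrt (f * (1 - f))) +
              C₁ * B * (1 + Real.sqrt (Real.log (1 / δ))) /
                ((1 - f) * Real.sqrt ((N : ℝ) * f)))).card : ℝ)
      ≥ (1 - δ) * ((Finset.powersetCard m (Finset.univ : Finset (Pairs n))).card : ℝ) := by
  refine ⟨9, by norm_num, ?_⟩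
  intro n hn G K hK Ktil hKtil N hN y hy f hf hf2 m hm hmN C hC ρ B hρ hB ℓ hℓ hlip δ hδ hδ1
  have hcard := card_pairs n
  rw [← hN] at hcard
  have hn' : (3 : ℝ) ≤ n := by exact_mod_cast hn
  have hcard' : 2 * (N : ℝ) = n * (n - 1) := by
    have := congrArg (Nat.cast : ℕ → ℝ) hcard
    push_cast [Nat.cast_sub (show 1 ≤ n by omega)] at this
    exact this
  have hN0 : (0 : ℝ) < N := by nlinarith
  have hm1 : (N : ℝ) * f ≤ m := by rw [hm]; exact Nat.le_ceil _
  have hm2 : (m : ℝ) < N * f + 1 := by rw [hm]; exact Nat.ceil_lt_add_one (by positivity)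
  have hmN' : (m : ℝ) < N := by exact_mod_cast hmN
  have hm0' : (0 : ℝ) < m := lt_of_lt_of_le (by positivity) hm1
  have hm0 : 0 < m := by exact_mod_cast hm0'
  have hL : 0 ≤ Real.log (1 / δ) := Real.log_nonneg (by rw [le_div_iff₀ hδ]; linarith)
  set L := Real.log (1 / δ)
  have hlam : 0 ≤ lam1 K := by
    have h1 := sum_sq_pairDiff_gram_le hK
    have h2 : (0 : ℝ) < (n : ℝ) ^ 3 := by positivity
    by_contra! h
    have h3 : 0 ≤ ∑ k, ∑ l, ((pairDiffMat n)ᵀ * K * pairDiffMat n) k l ^ 2 := by positivity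
    nlinarith
  set X := 2 * C * √((n : ℝ) * lam1 K) / (ρ * √(f * (1 - f))) with hX
  set Y := 9 * B * (1 + √L) / ((1 - f) * √((N : ℝ) * f)) with hY
  have hY0 : 0 ≤ Y := by
    have : 0 < 1 - f := by linarith
    positivity
  have hX0 : 0 ≤ X := by positivity
  let good : Finset (Pairs n) → (Pairs n → ℝ) → Prop := fun S β =>
    (1 / ((N : ℝ) - m)) * ∑ k ∈ Sᶜ, ℓ (y k) ((Ktil *ᵥ β) k) ≤
      (1 / (m : ℝ)) * ∑ k ∈ S, ℓ (y k) ((Ktil *ᵥ β) k) + X + Y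
  have hchoice : ∀ S : Finset (Pairs n), ∃ β : Pairs n → ℝ, √(β ⬝ᵥ β) ≤ C * √(N : ℝ) ∧
      ((∃ β' : Pairs n → ℝ, √(β' ⬝ᵥ β') ≤ C * √(N : ℝ) ∧ ¬ good S β') → ¬ good S β) := by
    intro S
    by_cases h : ∃ β' : Pairs n → ℝ, √(β' ⬝ᵥ β') ≤ C * √(N : ℝ) ∧ ¬ good S β'
    · obtain ⟨β, h1, h2⟩ := h
      exact ⟨β, h1, fun _ => h2⟩
    · exact ⟨0, by simp; positivity, fun h' => absurd h' h⟩
  choose β hβ hβbad using hchoice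
  set q : ℝ := m / N with hq
  set w : Pairs n → EuclideanSpace ℝ (Pairs n) := fun k => (1 / ρ) • WithLp.toLp 2 (Ktil k) with hw
  set u : Pairs n → Finset (Pairs n) → ℝ := fun k S => ℓ (y k) ((Ktil *ᵥ β S) k) with hu
  have hinner : ∀ k S, inner ℝ (w k) (WithLp.toLp 2 (β S)) = (1 / ρ) * (Ktil *ᵥ β S) k := by
    intro k S
    rw [hw, real_inner_smul_left, EuclideanSpace.inner_toLp_toLp]
    simp [mulVec, dotProduct_comm]
  have hconc := card_filter_ciSup_lt_le w (fun S => WithLp.toLp 2 (β S)) (R := C * √(N : ℝ))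
    (fun S => by
      refine le_trans (le_of_eq ?_) (hβ S)
      rw [EuclideanSpace.norm_eq]
      simp [dotProduct, sq]) u
    (fun k i j => by
      rw [hinner, hinner, ← mul_sub, abs_mul, abs_of_pos (show 0 < 1 / ρ by positivity)]
      exact hlip _ _ _ (hy k)) hB (fun k i => hℓ _ _ (hy k)) hm0 (by omega)
    (q := q) (by rw [hq, hN]) hδ hδ1
  have hW : ∑ k, ‖w k‖ ^ 2 ≤ (n : ℝ) ^ 3 * lam1 K / ρ ^ 2 := by
    have h1 : ∀ k, ‖w k‖ ^ 2 = (∑ l, Ktil k l ^ 2) / ρ ^ 2 := by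
      intro k
      rw [hw, norm_smul, mul_pow, EuclideanSpace.norm_sq_eq]
      simp [div_eq_inv_mul]
    rw [sum_congr rfl fun k _ => h1 k, ← sum_div, hKtil]
    gcongr
    exact sum_sq_pairDiff_gram_le hK
  rw [← hN] at hconc
  set thr := C * √(N : ℝ) * √(2 * (q * (1 - q)) * ∑ k, ‖w k‖ ^ 2) +
    B * √(N * (q * (1 - q))) + B * √(8 * m * L) with hthr
  have hbad : ∀ S ∈ powersetCard m (univ : Finset (Pairs n)),
      (∃ β' : Pairs n → ℝ, √(β' ⬝ᵥ β') ≤ C * √(N : ℝ) ∧ ¬ good S β') →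
        thr < ⨆ i, ∑ k, (q - if k ∈ S then 1 else 0) * u k i := by
    intro S hS hex
    have hSm : #S = m := (mem_powersetCard.1 hS).2
    have h1 : X + Y < (1 / ((N : ℝ) - m)) * ∑ k ∈ Sᶜ, u k S - (1 / (m : ℝ)) * ∑ k ∈ S, u k S := by
      have := hβbad S hex
      simp only [good, not_le] at this
      simp only [hu]
      linarith
    have hu0 : 0 < (N : ℝ) - m := by linarith
    have hle : (1 / ((N : ℝ) - m)) * ∑ k ∈ Sᶜ, u k S ≤ B := by
      have : ∑ k ∈ Sᶜ, u k S ≤ ((N : ℝ) - m) * B := by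
        refine (sum_le_card_nsmul _ _ B fun k _ => (hℓ _ _ (hy k)).2).trans_eq ?_
        rw [card_compl, hSm, ← hN, nsmul_eq_mul, Nat.cast_sub hmN.le]
      rw [one_div, inv_mul_le_iff₀ hu0]
      exact this
    have hge : 0 ≤ (1 / (m : ℝ)) * ∑ k ∈ S, u k S :=
      mul_nonneg (by positivity) (sum_nonneg fun k _ => (hℓ _ _ (hy k)).1)
    have hthr' := threshold_le hn' hcard' hf hf2 hm1 hm2 hmN' hC hρ hB hL hq hW hlam
      (by rw [← hX]; linarith)
    rw [← hthr, ← hX, ← hY] at hthr'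
    have hsum : (1 / ((N : ℝ) - m)) * ∑ k ∈ Sᶜ, u k S - (1 / (m : ℝ)) * ∑ k ∈ S, u k S =
        N / (m * (N - m)) * ∑ k, (q - if k ∈ S then 1 else 0) * u k S := by
      rw [← sum_add_sum_compl S (fun k => (q - if k ∈ S then 1 else 0) * u k S)]
      have a1 : ∑ k ∈ S, (q - if k ∈ S then 1 else 0) * u k S = (q - 1) * ∑ k ∈ S, u k S := by
        rw [mul_sum]; exact sum_congr rfl fun k hk => by rw [if_pos hk]
      have a2 : ∑ k ∈ Sᶜ, (q - if k ∈ S then 1 else 0) * u k S = q * ∑ k ∈ Sᶜ, u k S := by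
        rw [mul_sum]; exact sum_congr rfl fun k hk => by rw [if_neg (mem_compl.1 hk), sub_zero]
      rw [a1, a2, hq]
      field_simp
      ring
    rw [hsum] at h1
    have h2 := lt_of_mul_lt_mul_left (hthr'.trans_lt h1) (by positivity)
    exact h2.trans_le (le_ciSup (f := fun i => ∑ k, (q - if k ∈ S then 1 else 0) * u k i)
      (Set.finite_range _).bddAbove S)
  set P := powersetCard m (univ : Finset (Pairs n))
  have hsplit := card_filter_add_card_filter_not (s := P)
    (fun S => ∀ β : Pairs n → ℝ, √(β ⬝ᵥ β) ≤ C * √(N : ℝ) → good S β)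
  have hsub : #{S ∈ P | ¬ ∀ β : Pairs n → ℝ, √(β ⬝ᵥ β) ≤ C * √(N : ℝ) → good S β} ≤
      #{S ∈ P | thr < ⨆ i, ∑ k, (q - if k ∈ S then 1 else 0) * u k i} := by
    refine card_le_card fun S hS => ?_
    rw [mem_filter] at hS ⊢
    refine ⟨hS.1, hbad S hS.1 ?_⟩
    have := hS.2
    push Not at this
    exact this
  have hsplit' := congrArg (Nat.cast : ℕ → ℝ) hsplit
  have hsub' := (Nat.cast_le (α := ℝ)).2 hsub
  push_cast at hsplit'
  have hfinal : (1 - δ) * (#P : ℝ) ≤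
      #{S ∈ P | ∀ β : Pairs n → ℝ, √(β ⬝ᵥ β) ≤ C * √(N : ℝ) → good S β} := by
    linarith
  exact hfinal
end
end

section
/- Let G be a finite simple graph on vertex set {1,…,n} with adjacency matrix A_G, let τ > 0 satisfy τ ≥ |λ_n(A_G)| where λ_n(A_G) is the smallest eigenvalue of A_G, set K_LS = A_G/τ + I_n and K̃_LS = K_LS ⊗ K_LS (an n²×n² matrix). Let C > 0, p ∈ [0, 1/2], and let γ = (γ_1, …, γ_{n²}) be independent random variables each taking the value 1 with probability p, the value −1 with probability p, and the value 0 with probability 1−2p. Then (1/n²) · E[ sup_{β ∈ ℝ^{n²}, ‖β‖_∞ ≤ C} βᵀ K̃_LS γ ] ≤ C √(2p) · (1 + λ1(A_G)/τ), where λ1(A_G) is the largest eigenvalue of A_G. -/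
noncomputable section
open Finset Matrix Kronecker

/-- The three possible outcomes of a transductive-Rademacher variable have
probabilities `p`, `p`, `1 - 2p` ... -/
def radW (p : ℝ) : Fin 3 → ℝ := ![p, p, 1 - 2 * p]

/-- ... and values `1`, `-1`, `0` respectively. -/
def radV : Fin 3 → ℝ := ![1, -1, 0]

/-- Expectation of `h γ` where `γ = (γ_1, …, γ_N)` (indexed by `ι`) is a vector of i.i.d.
random variables taking value `1` w.p. `p`, `-1` w.p. `p` and `0` w.p. `1 - 2p`. -/
def radExp {ι : Type*} [Fintype ι] [DecidableEq ι] (p : ℝ) (h : (ι → ℝ) → ℝ) : ℝ :=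
  ∑ g : ι → Fin 3, (∏ k, radW p (g k)) * h (fun k => radV (g k))


-- The smallest eigenvalue of a real symmetric matrix
-- (junk value `0` if the matrix is not symmetric).
open scoped Classical in
noncomputable def lamN {ι : Type*} [Fintype ι] [DecidableEq ι] (M : Matrix ι ι ℝ) : ℝ :=
  if h : M.IsHermitian then ⨅ i, h.eigenvalues i else 0

section RademacherMoments

variable {ι : Type*} [Fintype ι] {p : ℝ}

theorem prod_radW_nonneg (hp0 : 0 ≤ p) (hp : p ≤ 1 / 2) (g : ι → Fin 3) :
    0 ≤ ∏ k, radW p (g k) := by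
  refine Finset.prod_nonneg fun k _ => ?_
  generalize g k = j
  fin_cases j <;> simp [radW] <;> linarith

variable [DecidableEq ι]

theorem radExp_mono (hp0 : 0 ≤ p) (hp : p ≤ 1 / 2) {f h : (ι → ℝ) → ℝ} (hfh : ∀ γ, f γ ≤ h γ) :
    radExp p f ≤ radExp p h :=
  Finset.sum_le_sum fun g _ => mul_le_mul_of_nonneg_left (hfh _) (prod_radW_nonneg hp0 hp g)

theorem radExp_const_mul (c : ℝ) (f : (ι → ℝ) → ℝ) :
    radExp p (fun γ => c * f γ) = c * radExp p f := by
  simp only [radExp, Finset.mul_sum]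
  exact Finset.sum_congr rfl fun g _ => by ring

theorem radExp_sum {κ : Type*} (s : Finset κ) (f : κ → (ι → ℝ) → ℝ) :
    radExp p (fun γ => ∑ k ∈ s, f k γ) = ∑ k ∈ s, radExp p (f k) := by
  simp only [radExp, Finset.mul_sum]
  exact Finset.sum_comm

theorem radExp_prod (f : ι → ℝ → ℝ) :
    radExp p (fun γ => ∏ k, f k (γ k)) = ∏ k, ∑ j, radW p j * f k (radV j) := by
  rw [Fintype.prod_sum]
  simp only [radExp, Finset.prod_mul_distrib]

theorem radExp_one : radExp p (fun _ : ι → ℝ => 1) = 1 := by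
  have h := radExp_prod (ι := ι) (p := p) (fun _ _ => 1)
  simp only [Finset.prod_const_one] at h
  rw [h]
  refine Finset.prod_eq_one fun k _ => ?_
  simp [Fin.sum_univ_three, radW]
  ring

theorem radExp_mul_apply (k l : ι) :
    radExp p (fun γ => γ k * γ l) = if k = l then 2 * p else 0 := by
  have h := radExp_prod (p := p)
    (fun m x => (if m = k then x else 1) * (if m = l then x else 1))
  simp only [Finset.prod_mul_distrib, Finset.prod_ite_eq', Finset.mem_univ, if_true] at h
  rw [h]
  split_ifs with hkl
  · subst hkl
    rw [Finset.prod_eq_single k]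
    · simp [Fin.sum_univ_three, radW, radV]
      ring
    · intro m _ hm
      simp [Fin.sum_univ_three, radW, hm]
      ring
    · simp
  · refine Finset.prod_eq_zero (Finset.mem_univ k) ?_
    simp [Fin.sum_univ_three, radW, radV, hkl]

theorem radExp_mulVec_sq (M : Matrix ι ι ℝ) (k : ι) :
    radExp p (fun γ => (M *ᵥ γ) k ^ 2) = 2 * p * ∑ l, M k l ^ 2 := by
  have h : ∀ γ : ι → ℝ, (M *ᵥ γ) k ^ 2 = ∑ l, ∑ m, (M k l * M k m) * (γ l * γ m) := by
    intro γ
    rw [sq, Matrix.mulVec, dotProduct, Finset.sum_mul_sum]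
    exact Finset.sum_congr rfl fun l _ => Finset.sum_congr rfl fun m _ => by ring
  simp only [h, radExp_sum, radExp_const_mul, radExp_mul_apply, mul_ite, mul_zero,
    Finset.sum_ite_eq, Finset.mem_univ, if_true, Finset.mul_sum]
  exact Finset.sum_congr rfl fun l _ => by ring

/-- Jensen's inequality for the square root, summed over the coordinates. -/
theorem radExp_sum_abs_mulVec_le (hp0 : 0 ≤ p) (hp : p ≤ 1 / 2) (M : Matrix ι ι ℝ) :
    radExp p (fun γ => ∑ k, |(M *ᵥ γ) k|) ≤
      √(Fintype.card ι * (2 * p * ∑ k, ∑ l, M k l ^ 2)) := by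
  have hsq : radExp p (fun γ : ι → ℝ => ∑ k, |(M *ᵥ γ) k| ^ 2) =
      2 * p * ∑ k, ∑ l, M k l ^ 2 := by
    simp only [sq_abs]
    rw [radExp_sum]
    simp only [radExp_mulVec_sq, Finset.mul_sum]
  have hone : radExp p (fun _ : ι → ℝ => ∑ _k : ι, (1 : ℝ)) = Fintype.card ι := by
    rw [radExp_sum]
    simp [radExp_one]
  refine Real.le_sqrt_of_sq_le ?_
  rw [← hsq, ← hone]
  have hflat : ∀ f : ι → (ι → ℝ) → ℝ, radExp p (fun γ => ∑ k, f k γ) =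
      ∑ x : (ι → Fin 3) × ι, (∏ k, radW p (x.1 k)) * f x.2 (fun k => radV (x.1 k)) := by
    intro f
    simp only [radExp, Finset.mul_sum, Fintype.sum_prod_type]
  rw [hflat fun k γ => |(M *ᵥ γ) k|, hflat fun _ _ => 1, hflat fun k γ => |(M *ᵥ γ) k| ^ 2]
  refine Finset.sum_sq_le_sum_mul_sum_of_sq_le_mul _ (fun x _ => ?_) (fun x _ => ?_)
    fun x _ => le_of_eq ?_
  · exact mul_nonneg (prod_radW_nonneg hp0 hp x.1) zero_le_one
  · exact mul_nonneg (prod_radW_nonneg hp0 hp x.1) (sq_nonneg _)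
  · ring

end RademacherMoments

theorem sSup_dotProduct_le {ι : Type*} [Fintype ι] {C : ℝ} (hC : 0 ≤ C) (v : ι → ℝ) :
    sSup {x : ℝ | ∃ β : ι → ℝ, (∀ k, |β k| ≤ C) ∧ x = β ⬝ᵥ v} ≤ C * ∑ k, |v k| := by
  refine Real.sSup_le ?_ (by positivity)
  rintro x ⟨β, hβ, rfl⟩
  rw [dotProduct, Finset.mul_sum]
  refine Finset.sum_le_sum fun k _ => (le_abs_self _).trans ?_
  rw [abs_mul]
  exact mul_le_mul_of_nonneg_right (hβ k) (abs_nonneg _)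

theorem sum_sq_kronecker {ι κ : Type*} [Fintype ι] [Fintype κ]
    (A : Matrix ι ι ℝ) (B : Matrix κ κ ℝ) :
    ∑ k, ∑ l, (A ⊗ₖ B) k l ^ 2 = (∑ i, ∑ j, A i j ^ 2) * ∑ i, ∑ j, B i j ^ 2 := by
  simp only [Fintype.sum_prod_type, kroneckerMap_apply, mul_pow, ← Finset.mul_sum,
    ← Finset.sum_mul]

theorem sum_sq_entries_eq_sum_sq_eigenvalues {ι : Type*} [Fintype ι] [DecidableEq ι]
    {M : Matrix ι ι ℝ} (hM : M.IsHermitian) :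
    ∑ i, ∑ j, M i j ^ 2 = ∑ i, hM.eigenvalues i ^ 2 := by
  have h1 : ∑ i, ∑ j, M i j ^ 2 = (M * M).trace := by
    simp only [Matrix.trace, Matrix.diag_apply, Matrix.mul_apply]
    refine Finset.sum_congr rfl fun i _ => Finset.sum_congr rfl fun j _ => ?_
    have : M j i = M i j := by simpa using hM.apply i j
    rw [this, sq]
  have h2 : M * M = Unitary.conjStarAlgAut ℝ _ hM.eigenvectorUnitary
      (diagonal hM.eigenvalues * diagonal hM.eigenvalues) := by
    conv_lhs => rw [hM.spectral_theorem]
    rw [← map_mul]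
    rfl
  rw [h1, h2, Unitary.conjStarAlgAut_apply, Matrix.trace_mul_cycle]
  simp [Matrix.trace, sq]

/-- If `τ` dominates the smallest eigenvalue of a zero-trace symmetric matrix `A` in absolute
value, the squared Frobenius norm of `A / τ + 1` is at most `n (1 + λ₁(A) / τ)`. -/
theorem sum_sq_smul_add_one_le {ι : Type*} [Fintype ι] [DecidableEq ι]
    {A : Matrix ι ι ℝ} (hA : A.IsHermitian) (htr : A.trace = 0) {τ : ℝ} (hτ0 : 0 < τ)
    (hτ : |lamN A| ≤ τ) :
    ∑ i, ∑ j, (τ⁻¹ • A + 1) i j ^ 2 ≤ Fintype.card ι * (1 + lam1 A / τ) := by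
  have hsum : ∑ i, hA.eigenvalues i = 0 := by
    have h := hA.trace_eq_sum_eigenvalues
    rw [htr] at h
    simpa using h.symm
  have hup : ∀ i, hA.eigenvalues i ≤ lam1 A := fun i => by
    rw [lam1, dif_pos hA]
    exact le_ciSup (Set.finite_range _).bddAbove i
  have hlow : ∀ i, -τ ≤ hA.eigenvalues i := fun i => by
    rw [lamN, dif_pos hA] at hτ
    exact (abs_le.mp hτ).1.trans (ciInf_le (Set.finite_range _).bddBelow i)
  have hexp : ∑ i, ∑ j, (τ⁻¹ • A + 1) i j ^ 2 =
      τ⁻¹ ^ 2 * ∑ i, hA.eigenvalues i ^ 2 + Fintype.card ι := by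
    have hent : ∀ i j, (τ⁻¹ • A + 1) i j ^ 2 =
        τ⁻¹ ^ 2 * A i j ^ 2 + if i = j then 2 * τ⁻¹ * A i i + 1 else 0 := by
      intro i j
      by_cases h : i = j
      · subst h
        simp
        ring
      · simp [h]
        ring
    have hdiag : ∑ i, A i i = 0 := htr
    simp only [hent, Finset.sum_add_distrib, Finset.sum_ite_eq, Finset.mem_univ, if_true,
      ← Finset.mul_sum, sum_sq_entries_eq_sum_sq_eigenvalues hA, hdiag]
    simp
  have hkey : 0 ≤ ∑ i, (lam1 A - hA.eigenvalues i) * (hA.eigenvalues i + τ) :=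
    Finset.sum_nonneg fun i _ =>
      mul_nonneg (sub_nonneg.mpr (hup i)) (by linarith [hlow i])
  have hkey' : ∑ i, (lam1 A - hA.eigenvalues i) * (hA.eigenvalues i + τ) =
      Fintype.card ι * (lam1 A * τ) - ∑ i, hA.eigenvalues i ^ 2 := by
    have : ∀ i, (lam1 A - hA.eigenvalues i) * (hA.eigenvalues i + τ) =
        lam1 A * τ - hA.eigenvalues i ^ 2 + (lam1 A - τ) * hA.eigenvalues i := fun i => by ring
    simp only [this, Finset.sum_add_distrib, Finset.sum_sub_distrib, ← Finset.mul_sum, hsum]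
    simp
    ring
  have hle : ∑ i, hA.eigenvalues i ^ 2 ≤ Fintype.card ι * (lam1 A * τ) := by linarith
  rw [hexp]
  calc τ⁻¹ ^ 2 * ∑ i, hA.eigenvalues i ^ 2 + Fintype.card ι
      ≤ τ⁻¹ ^ 2 * (Fintype.card ι * (lam1 A * τ)) + Fintype.card ι := by gcongr
    _ = Fintype.card ι * (1 + lam1 A / τ) := by
      field_simp
      ring

/-- for the LS-labelling `K_LS = A_G/τ + I` (with `τ > 0`,
`τ ≥ |λ_n(A_G)|`) and `K̃_LS = K_LS ⊗ K_LS`, the transductive Rademacher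
complexity is at most `C √(2p) (1 + λ1(A_G)/τ)`. -/
theorem stmt_16 (n : ℕ) (G : SimpleGraph (Fin n)) [DecidableRel G.Adj]
    (τ : ℝ) (hτ0 : 0 < τ) (hτ : |lamN (G.adjMatrix ℝ)| ≤ τ)
    (C p : ℝ) (hC : 0 < C) (hp0 : 0 ≤ p) (hp : p ≤ 1 / 2) :
    (1 / ((n : ℝ) ^ 2)) * radExp p (fun γ : Fin n × Fin n → ℝ =>
        sSup {x : ℝ | ∃ β : Fin n × Fin n → ℝ, (∀ k, |β k| ≤ C) ∧
          x = β ⬝ᵥ (((τ⁻¹ • G.adjMatrix ℝ + 1) ⊗ₖ (τ⁻¹ • G.adjMatrix ℝ + 1)) *ᵥ γ)})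
      ≤ C * Real.sqrt (2 * p) * (1 + lam1 (G.adjMatrix ℝ) / τ) := by
  set K := τ⁻¹ • G.adjMatrix ℝ + 1 with hK
  set F := ∑ i, ∑ j, K i j ^ 2 with hF
  have hF0 : 0 ≤ F := by positivity
  have hFle : F ≤ n * (1 + lam1 (G.adjMatrix ℝ) / τ) := by
    have h := sum_sq_smul_add_one_le (G.isHermitian_adjMatrix ℝ) (G.trace_adjMatrix ℝ) hτ0 hτ
    rwa [Fintype.card_fin] at h
  have hE : radExp p (fun γ : Fin n × Fin n → ℝ =>
      sSup {x : ℝ | ∃ β : Fin n × Fin n → ℝ, (∀ k, |β k| ≤ C) ∧ x = β ⬝ᵥ ((K ⊗ₖ K) *ᵥ γ)}) ≤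
      C * (√(2 * p) * (n * F)) := by
    calc _ ≤ C * radExp p (fun γ => ∑ k, |((K ⊗ₖ K) *ᵥ γ) k|) := by
          rw [← radExp_const_mul]
          exact radExp_mono hp0 hp fun γ => sSup_dotProduct_le hC.le _
      _ ≤ C * √(Fintype.card (Fin n × Fin n) * (2 * p * ∑ k, ∑ l, (K ⊗ₖ K) k l ^ 2)) := by
          gcongr
          exact radExp_sum_abs_mulVec_le hp0 hp _
      _ = C * (√(2 * p) * (n * F)) := by
          rw [sum_sq_kronecker, ← hF, Fintype.card_prod, Fintype.card_fin]
          have : ((n * n : ℕ) : ℝ) * (2 * p * (F * F)) = 2 * p * (n * F) ^ 2 := by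
            push_cast
            ring
          rw [this, Real.sqrt_mul (by positivity), Real.sqrt_sq (by positivity)]
  rcases Nat.eq_zero_or_pos n with rfl | hn
  · have : lam1 (G.adjMatrix ℝ) = 0 := by simp [lam1]
    rw [this]
    simp
    positivity
  · have hn' : (0 : ℝ) < n := by exact_mod_cast hn
    calc _ ≤ 1 / (n : ℝ) ^ 2 * (C * (√(2 * p) * (n * F))) := by gcongr
      _ ≤ 1 / (n : ℝ) ^ 2 *
          (C * (√(2 * p) * (n * (n * (1 + lam1 (G.adjMatrix ℝ) / τ))))) := by gcongr
      _ = C * √(2 * p) * (1 + lam1 (G.adjMatrix ℝ) / τ) := by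
        field_simp
end
end
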